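/- Suppose the covariate density g is bounded, bounded away from zero on [0,1], and uniformly continuous on [0,1]; the kernel w is a symmetric density with compact support [−1,1] and bounded derivative; f has mean zero and finite absolute moment of order β > 2; and c_n → 0 with c_n^{−1} n^{2/β} = O(n/log n). Then sup_{0≤x≤1} | (1/n) Σ_{j=1}^n Ā_n(x, Z_j) ε_j | = O_p((n c_n / log n)^{−1/2}). -/

import Mathlib

open MeasureTheory ProbabilityTheory Filter

/-- The re-scaled kernel `w_{nm}(u) = (u^m / c^{m+1}) w(u/c)`. -/
noncomputable def wnm (w : ℝ → ℝ) (c : ℝ) (m : ℕ) (u : ℝ) : ℝ :=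
  u ^ m / c ^ (m + 1) * w (u / c)

/-- `q̄_{nm}(x) = ∫ g(x + c t) t^m w(t) dt`. -/
noncomputable def qbar (g w : ℝ → ℝ) (c : ℝ) (m : ℕ) (x : ℝ) : ℝ :=
  ∫ t, g (x + c * t) * t ^ m * w t

/-- The matrix `Q̄_n(x)` with `(k,m)`-entry `q̄_{n,k+m}(x)`. -/
noncomputable def Qbar (g w : ℝ → ℝ) (c : ℝ) (d : ℕ) (x : ℝ) :
    Matrix (Fin (d + 1)) (Fin (d + 1)) ℝ :=
  Matrix.of fun k m : Fin (d + 1) => qbar g w c ((k : ℕ) + (m : ℕ)) x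

/-- `Ā_n(x,y) = p̄_n(x)ᵀ w_n(y-x)`, with `p̄_n(x)` the first column of `Q̄_n(x)⁻¹`. -/
noncomputable def Abar (g w : ℝ → ℝ) (c : ℝ) (d : ℕ) (x y : ℝ) : ℝ :=
  ∑ m : Fin (d + 1), (Qbar g w c d x)⁻¹ m 0 * wnm w c (m : ℕ) (y - x)

/-- A coercive quadratic form bounds the entries of the first column of the inverse matrix. -/
lemma abs_inv_apply_zero_le {d : ℕ} (Q : Matrix (Fin (d + 1)) (Fin (d + 1)) ℝ) {l : ℝ}
    (hl : 0 < l)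
    (hQ : ∀ v : Fin (d + 1) → ℝ, l * ∑ i, v i ^ 2 ≤ v ⬝ᵥ (Q.mulVec v)) (m : Fin (d + 1)) :
    |Q⁻¹ m 0| ≤ l⁻¹ := by
  by_cases hu : IsUnit Q.det
  · set u : Fin (d + 1) → ℝ := fun i => Q⁻¹ i 0 with hu_def
    have hmul : Q.mulVec u = Pi.single 0 1 := by
      have h1 : u = Q⁻¹.mulVec (Pi.single 0 1) := by
        ext i; simp [hu_def]
      rw [h1, Matrix.mulVec_mulVec, Matrix.mul_nonsing_inv _ hu, Matrix.one_mulVec]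
    have h := hQ u
    rw [hmul, dotProduct_single, mul_one] at h
    have hle : ∀ i, u i ^ 2 ≤ ∑ i, u i ^ 2 := fun i =>
      Finset.single_le_sum (f := fun i => u i ^ 2) (fun i _ => sq_nonneg _) (Finset.mem_univ i)
    have h0 := hle 0
    have hm := hle m
    have hli : l * l⁻¹ = 1 := mul_inv_cancel₀ hl.ne'
    have hlp : 0 < l⁻¹ := inv_pos.2 hl
    have hsum : ∑ i, u i ^ 2 ≤ l⁻¹ * u 0 := by
      rw [inv_mul_eq_div, le_div_iff₀ hl]; linarith
    have hu0 : u 0 ≤ l⁻¹ := by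
      by_contra hcon
      push Not at hcon
      nlinarith
    apply abs_le_of_sq_le_sq _ hlp.le
    change u m ^ 2 ≤ _
    nlinarith
  · rw [Matrix.nonsing_inv_apply_not_isUnit _ hu]
    simpa using hl.le

/-- The zero set of a nonzero polynomial function is finite. -/
lemma finite_zeros_sum_pow {d : ℕ} {v : Fin (d + 1) → ℝ} (hv : v ≠ 0) :
    {t : ℝ | ∑ i, v i * t ^ (i : ℕ) = 0}.Finite := by
  set p : Polynomial ℝ := ∑ i : Fin (d + 1), Polynomial.monomial (i : ℕ) (v i) with hp
  have hcoeff : ∀ i : Fin (d + 1), p.coeff i = v i := by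
    intro i
    simp [hp, Polynomial.coeff_monomial, Fin.val_inj]
  have hp0 : p ≠ 0 := by
    intro h
    apply hv
    ext i
    rw [← hcoeff i, h]; simp
  refine (p.roots.toFinset.finite_toSet).subset ?_
  intro t ht
  simp only [Set.mem_ofPred_eq] at ht
  simp only [Finset.mem_coe, Multiset.mem_toFinset, Polynomial.mem_roots hp0, Polynomial.IsRoot]
  rw [hp, Polynomial.eval_finsetSum]
  simpa [Polynomial.eval_monomial] using ht

/-- Quadratic form of the truncated moment matrix of `w` on `S` is coercive. -/
lemma exists_coercive_setIntegral {w : ℝ → ℝ} (hw0 : ∀ x, 0 ≤ w x) (hwc : Continuous w)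
    {a b : ℝ} (hpos : 0 < ∫ t in Set.Icc a b, w t) (d : ℕ) :
    ∃ l > 0, ∀ v : Fin (d + 1) → ℝ,
      l * ∑ i, v i ^ 2 ≤ ∫ t in Set.Icc a b, (∑ i, v i * t ^ (i : ℕ)) ^ 2 * w t := by
  set F : (Fin (d + 1) → ℝ) → ℝ :=
    fun v => ∫ t in Set.Icc a b, (∑ i, v i * t ^ (i : ℕ)) ^ 2 * w t with hF
  have hFcont : Continuous F := by
    apply continuous_parametric_integral_of_continuous (by fun_prop) isCompact_Icc
  have hFpos : ∀ v, v ≠ 0 → 0 < F v := by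
    intro v hv
    have hInt : IntegrableOn (fun t => (∑ i, v i * t ^ (i : ℕ)) ^ 2 * w t) (Set.Icc a b) :=
      (by fun_prop : Continuous _).continuousOn.integrableOn_compact isCompact_Icc
    have hnn : ∀ t, 0 ≤ (∑ i, v i * t ^ (i : ℕ)) ^ 2 * w t := fun t =>
      mul_nonneg (sq_nonneg _) (hw0 t)
    refine lt_of_le_of_ne (integral_nonneg hnn) fun h => hpos.ne' ?_
    have h1 := (setIntegral_eq_zero_iff_of_nonneg_ae (Eventually.of_forall hnn) hInt).1 h.symm
    refine integral_eq_zero_of_ae ?_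
    have h2 : ∀ᵐ t ∂(volume.restrict (Set.Icc a b)), ¬ (∑ i, v i * t ^ (i : ℕ) = 0) :=
      ae_restrict_of_ae (measure_eq_zero_iff_ae_notMem.1
        ((finite_zeros_sum_pow hv).measure_zero volume))
    filter_upwards [h1, h2] with t ht1 ht2
    simpa [ht2] using ht1
  have hcomp : IsCompact {v : Fin (d + 1) → ℝ | ∑ i, v i ^ 2 = 1} := by
    refine (isCompact_univ_pi (fun _ : Fin (d + 1) => isCompact_Icc (a := (-1 : ℝ))
      (b := 1))).of_isClosed_subset (isClosed_eq (by fun_prop) (by fun_prop)) ?_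
    intro v hv i _
    have : v i ^ 2 ≤ 1 := by
      rw [← (show _ = _ from hv)]
      exact Finset.single_le_sum (f := fun i => v i ^ 2) (fun i _ => sq_nonneg _)
        (Finset.mem_univ i)
    exact abs_le.1 ((sq_le_one_iff_abs_le_one _).1 this)
  have hne : {v : Fin (d + 1) → ℝ | ∑ i, v i ^ 2 = 1}.Nonempty :=
    ⟨Pi.single 0 1, by simp [Pi.single_apply, ite_pow]⟩
  obtain ⟨v₀, hv₀, hmin⟩ := hcomp.exists_isMinOn hne hFcont.continuousOn
  refine ⟨F v₀, hFpos v₀ ?_, fun v => ?_⟩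
  · rintro rfl
    simp at hv₀
  · by_cases hv : ∑ i, v i ^ 2 = 0
    · rw [hv, mul_zero]
      exact integral_nonneg fun t => mul_nonneg (sq_nonneg _) (hw0 t)
    have hs : 0 < ∑ i, v i ^ 2 :=
      lt_of_le_of_ne (Finset.sum_nonneg fun i _ => sq_nonneg _) (Ne.symm hv)
    set r := Real.sqrt (∑ i, v i ^ 2) with hr
    have hr0 : 0 < r := Real.sqrt_pos.2 hs
    have hr2 : r ^ 2 = ∑ i, v i ^ 2 := Real.sq_sqrt hs.le
    have hmem : (fun i => r⁻¹ * v i) ∈ {v : Fin (d + 1) → ℝ | ∑ i, v i ^ 2 = 1} := by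
      simp only [Set.mem_ofPred_eq, mul_pow, ← Finset.mul_sum, ← hr2]
      field_simp
    have h := hmin hmem
    have hscale : F (fun i => r⁻¹ * v i) = r⁻¹ ^ 2 * F v := by
      simp only [hF, ← integral_const_mul]
      congr 1
      ext t
      simp only [mul_assoc, ← Finset.mul_sum]
      ring
    simp only [Set.mem_ofPred_eq, hscale] at h
    rw [← hr2]
    calc F v₀ * r ^ 2 ≤ (r⁻¹ ^ 2 * F v) * r ^ 2 := by gcongr
      _ = F v := by field_simp

/-- A symmetric density with support in `[-1, 1]` gives positive mass to both halves. -/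
lemma setIntegral_half_pos {w : ℝ → ℝ} (hwInt : Integrable w) (hwdens : ∫ x, w x = 1)
    (hwsym : ∀ x, w (-x) = w x) (hwsupp : Function.support w ⊆ Set.Icc (-1) 1) :
    0 < ∫ t in Set.Icc (0 : ℝ) 1, w t ∧ 0 < ∫ t in Set.Icc (-1 : ℝ) 0, w t := by
  have h1 : ∫ t in Set.Ioi (0 : ℝ), w t = ∫ t in Set.Iic (0 : ℝ), w t := by
    simpa [hwsym] using integral_comp_neg_Ioi (0 : ℝ) w
  have h2 := intervalIntegral.integral_Iic_add_Ioi (b := (0 : ℝ)) hwInt.integrableOn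
    hwInt.integrableOn
  have hz : ∀ t, t ∉ Set.Icc (-1 : ℝ) 1 → w t = 0 := fun t ht =>
    Function.notMem_support.1 fun h => ht (hwsupp h)
  have h3 : ∫ t in Set.Icc (0 : ℝ) 1, w t = ∫ t in Set.Ioi (0 : ℝ), w t := by
    rw [← integral_Ici_eq_integral_Ioi]
    exact (setIntegral_eq_of_subset_of_forall_sdiff_eq_zero measurableSet_Ici
      (fun t ht => ht.1) fun t ht => hz t fun h => ht.2 (Set.mem_Icc.2 ⟨ht.1, h.2⟩)).symm
  have h4 : ∫ t in Set.Icc (-1 : ℝ) 0, w t = ∫ t in Set.Iic (0 : ℝ), w t :=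
    (setIntegral_eq_of_subset_of_forall_sdiff_eq_zero measurableSet_Iic
      (fun t ht => ht.2) fun t ht => hz t fun h => ht.2 (Set.mem_Icc.2 ⟨h.1, ht.1⟩)).symm
  rw [h3, h4]
  constructor <;> linarith

lemma mul_sum_pow_sq_mul_eq {d : ℕ} (a b t : ℝ) (v : Fin (d + 1) → ℝ) :
    a * ((∑ i, v i * t ^ (i : ℕ)) ^ 2 * b)
      = ∑ i, ∑ j, (v i * v j) * (a * t ^ ((i : ℕ) + (j : ℕ)) * b) := by
  rw [sq, Finset.sum_mul_sum, Finset.sum_mul, Finset.mul_sum]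
  refine Finset.sum_congr rfl fun i _ => ?_
  rw [Finset.sum_mul, Finset.mul_sum]
  refine Finset.sum_congr rfl fun j _ => ?_
  rw [pow_add]; ring

lemma dotProduct_Qbar_mulVec (g w : ℝ → ℝ) (c : ℝ) (d : ℕ) (x : ℝ)
    (hInt : ∀ m : ℕ, Integrable fun t => g (x + c * t) * t ^ m * w t)
    (v : Fin (d + 1) → ℝ) :
    v ⬝ᵥ ((Qbar g w c d x).mulVec v)
      = ∫ t, g (x + c * t) * ((∑ i, v i * t ^ (i : ℕ)) ^ 2 * w t) := by
  simp_rw [mul_sum_pow_sq_mul_eq]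
  rw [integral_finsetSum _ fun i _ => integrable_finsetSum _ fun j _ => (hInt _).const_mul _]
  simp only [dotProduct, Matrix.mulVec, Qbar, Matrix.of_apply, Finset.mul_sum]
  refine Finset.sum_congr rfl fun i _ => ?_
  rw [integral_finsetSum _ fun j _ => (hInt _).const_mul _]
  refine Finset.sum_congr rfl fun j _ => ?_
  rw [integral_const_mul, qbar]
  ring

/-- The first column of `Q̄(x)⁻¹` is bounded uniformly in `x ∈ [0,1]` and `c ∈ (0, 1/2]`. -/
lemma exists_bound_Qbar_inv {g w : ℝ → ℝ} (hg0 : ∀ x, 0 ≤ g x) (hgbdd : ∃ C, ∀ x, g x ≤ C)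
    (hglow : ∃ c₀ > (0 : ℝ), ∀ x ∈ Set.Icc (0 : ℝ) 1, c₀ ≤ g x)
    (hw0 : ∀ x, 0 ≤ w x) (hwInt : Integrable w) (hwdens : ∫ x, w x = 1)
    (hwsym : ∀ x, w (-x) = w x) (hwsupp : Function.support w ⊆ Set.Icc (-1) 1)
    (hwc : Continuous w) (d : ℕ) :
    ∃ K > 0, ∀ c : ℝ, 0 < c → c ≤ 1 / 2 → ∀ x ∈ Set.Icc (0 : ℝ) 1, ∀ m : Fin (d + 1),
      |(Qbar g w c d x)⁻¹ m 0| ≤ K := by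
  obtain ⟨C, hC⟩ := hgbdd
  obtain ⟨c₀, hc₀, hlow⟩ := hglow
  obtain ⟨hp1, hp2⟩ := setIntegral_half_pos hwInt hwdens hwsym hwsupp
  obtain ⟨l₁, hl₁, h₁⟩ := exists_coercive_setIntegral hw0 hwc hp1 d
  obtain ⟨l₂, hl₂, h₂⟩ := exists_coercive_setIntegral hw0 hwc hp2 d
  have hl : 0 < c₀ * min l₁ l₂ := mul_pos hc₀ (lt_min hl₁ hl₂)
  refine ⟨(c₀ * min l₁ l₂)⁻¹, inv_pos.2 hl, fun c hc hc2 x hx m => ?_⟩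
  by_cases hmeas : AEStronglyMeasurable fun t => g (x + c * t) * w t
  · have hInt : ∀ m : ℕ, Integrable fun t => g (x + c * t) * t ^ m * w t := by
      intro m
      refine (hwInt.const_mul C).mono' ?_ (Eventually.of_forall fun t => ?_)
      · have := hmeas.mul (continuous_pow m).aestronglyMeasurable
        exact this.congr (Eventually.of_forall fun t => by simp; ring)
      · by_cases ht : t ∈ Set.Icc (-1 : ℝ) 1
        · have ht1 : |t| ^ m ≤ 1 := pow_le_one₀ (abs_nonneg _) (abs_le.2 ht)
          rw [Real.norm_eq_abs, abs_mul, abs_mul, abs_pow, abs_of_nonneg (hg0 _),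
            abs_of_nonneg (hw0 t)]
          refine mul_le_mul_of_nonneg_right ?_ (hw0 t)
          calc g (x + c * t) * |t| ^ m ≤ g (x + c * t) * 1 :=
                mul_le_mul_of_nonneg_left ht1 (hg0 _)
            _ ≤ C := by simpa using hC _
        · have : w t = 0 := Function.notMem_support.1 fun h => ht (hwsupp h)
          simp [this]
    refine abs_inv_apply_zero_le _ hl (fun v => ?_) m
    rw [dotProduct_Qbar_mulVec g w c d x hInt v]
    have hsum : 0 ≤ ∑ i, v i ^ 2 := Finset.sum_nonneg fun i _ => sq_nonneg _
    have hGint : Integrable fun t => g (x + c * t) * ((∑ i, v i * t ^ (i : ℕ)) ^ 2 * w t) := by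
      simp_rw [mul_sum_pow_sq_mul_eq]
      exact integrable_finsetSum _ fun i _ => integrable_finsetSum _ fun j _ => (hInt _).const_mul _
    have key : ∀ a b l : ℝ, min l₁ l₂ ≤ l → (∀ t ∈ Set.Icc a b, x + c * t ∈ Set.Icc (0 : ℝ) 1) →
        (l * ∑ i, v i ^ 2 ≤ ∫ t in Set.Icc a b, (∑ i, v i * t ^ (i : ℕ)) ^ 2 * w t) →
        c₀ * min l₁ l₂ * ∑ i, v i ^ 2
          ≤ ∫ t, g (x + c * t) * ((∑ i, v i * t ^ (i : ℕ)) ^ 2 * w t) := by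
      intro a b l hl hab hlb
      calc c₀ * min l₁ l₂ * ∑ i, v i ^ 2 = c₀ * (min l₁ l₂ * ∑ i, v i ^ 2) := by ring
        _ ≤ c₀ * (l * ∑ i, v i ^ 2) := by gcongr
        _ ≤ c₀ * ∫ t in Set.Icc a b, (∑ i, v i * t ^ (i : ℕ)) ^ 2 * w t := by gcongr
        _ = ∫ t in Set.Icc a b, c₀ * ((∑ i, v i * t ^ (i : ℕ)) ^ 2 * w t) :=
          (integral_const_mul _ _).symm
        _ ≤ ∫ t in Set.Icc a b, g (x + c * t) * ((∑ i, v i * t ^ (i : ℕ)) ^ 2 * w t) := by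
          refine setIntegral_mono_on
            ((by fun_prop : Continuous _).continuousOn.integrableOn_compact isCompact_Icc)
            hGint.integrableOn measurableSet_Icc fun t ht => ?_
          exact mul_le_mul_of_nonneg_right (hlow _ (hab t ht))
            (mul_nonneg (sq_nonneg _) (hw0 t))
        _ ≤ _ := setIntegral_le_integral hGint (Eventually.of_forall fun t =>
            mul_nonneg (hg0 _) (mul_nonneg (sq_nonneg _) (hw0 t)))
    rcases le_total x (1 / 2) with hx2 | hx2
    · refine key 0 1 l₁ (min_le_left _ _) (fun t ht => ?_) (h₁ v)
      constructor <;> nlinarith [hx.1, hx.2, ht.1, ht.2]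
    · refine key (-1) 0 l₂ (min_le_right _ _) (fun t ht => ?_) (h₂ v)
      constructor <;> nlinarith [hx.1, hx.2, ht.1, ht.2]
  · have hq : ∀ m, qbar g w c m x = 0 := by
      intro m
      refine integral_undef fun h => hmeas ?_
      have h0 : ∀ᵐ t : ℝ, t ≠ 0 := by simp [ae_iff]
      have := h.1.mul ((measurable_id.pow_const m).inv.aestronglyMeasurable)
      refine this.congr ?_
      filter_upwards [h0] with t ht
      simp only [Pi.mul_apply, Pi.inv_apply, id]
      field_simp
    have : Qbar g w c d x = 0 := by
      ext i j; simp [Qbar, hq]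
    rw [this, Matrix.inv_zero, Matrix.zero_apply, abs_zero]
    exact (inv_pos.2 hl).le

/-- The kernels `t ^ m * w t` are bounded and Lipschitz, uniformly in `m ≤ d`. -/
lemma exists_bound_lipschitz_pow_mul {w : ℝ → ℝ}
    (hwsupp : Function.support w ⊆ Set.Icc (-1) 1)
    (hwdiff : Differentiable ℝ w) (hwderiv : ∃ M, ∀ x, |deriv w x| ≤ M) (d : ℕ) :
    ∃ B > 0, ∃ L > 0, ∀ m ≤ d, (∀ t : ℝ, |t ^ m * w t| ≤ B) ∧
      ∀ s t : ℝ, |s ^ m * w s - t ^ m * w t| ≤ L * |s - t| := by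
  obtain ⟨M, hM⟩ := hwderiv
  have hz : ∀ t, t ∉ Set.Icc (-1 : ℝ) 1 → w t = 0 := fun t ht =>
    Function.notMem_support.1 fun h => ht (hwsupp h)
  obtain ⟨B, hB⟩ := isCompact_Icc.exists_bound_of_continuousOn
    (s := Set.Icc (-1 : ℝ) 1) hwdiff.continuous.continuousOn
  have hB0 : 0 ≤ B := (norm_nonneg _).trans (hB 0 (by simp))
  have hM0 : 0 ≤ M := (abs_nonneg _).trans (hM 0)
  refine ⟨B + 1, by linarith, d * B + M + 1, by positivity,
    fun m hm => ⟨fun t => ?_, fun s t => ?_⟩⟩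
  · by_cases ht : t ∈ Set.Icc (-1 : ℝ) 1
    · rw [abs_mul, abs_pow]
      have h1 : |t| ^ m ≤ 1 := pow_le_one₀ (abs_nonneg _) (abs_le.2 ht)
      have h2 : |w t| ≤ B := hB t ht
      nlinarith [abs_nonneg (w t)]
    · simp [hz t ht]; linarith
  · have hdiff : Differentiable ℝ fun t : ℝ => t ^ m * w t := by fun_prop
    refine Convex.norm_image_sub_le_of_norm_deriv_le (f := fun t : ℝ => t ^ m * w t)
      (fun x _ => hdiff x) (fun x _ => ?_) convex_univ (Set.mem_univ t) (Set.mem_univ s)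
    by_cases hx : x ∈ Set.Icc (-1 : ℝ) 1
    · have hd : deriv (fun t : ℝ => t ^ m * w t) x = (m * x ^ (m - 1)) * w x + x ^ m * deriv w x :=
        ((hasDerivAt_pow m x).mul (hwdiff x).hasDerivAt).deriv
      have hx1 : |x| ≤ 1 := abs_le.2 hx
      have h1 : |x| ^ m ≤ 1 := pow_le_one₀ (abs_nonneg _) hx1
      have h2 : |x| ^ (m - 1) ≤ 1 := pow_le_one₀ (abs_nonneg _) hx1
      have h3 : |w x| ≤ B := hB x hx
      have hmd : (m : ℝ) ≤ d := by exact_mod_cast hm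
      rw [hd]
      calc ‖(m * x ^ (m - 1)) * w x + x ^ m * deriv w x‖
          ≤ |(m * x ^ (m - 1)) * w x| + |x ^ m * deriv w x| := abs_add_le _ _
        _ = m * |x| ^ (m - 1) * |w x| + |x| ^ m * |deriv w x| := by
          simp [abs_mul, abs_pow]
        _ ≤ d * 1 * B + 1 * M := by
          gcongr
          exact hM x
        _ ≤ _ := by linarith
    · have hev : (fun t : ℝ => t ^ m * w t) =ᶠ[nhds x] fun _ => 0 := by
        filter_upwards [isClosed_Icc.isOpen_compl.mem_nhds hx] with t ht
        simp [hz t ht]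
      rw [hev.deriv_eq]
      simp only [deriv_const, norm_zero]
      positivity

/-- Moment generating function bound for a bounded variable. -/
lemma mgf_le_exp_of_bounded {Ω : Type*} [MeasurableSpace Ω] {P : Measure Ω}
    [IsProbabilityMeasure P] {X : Ω → ℝ} (hX : Measurable X) {b l : ℝ}
    (hb : ∀ ω, |X ω| ≤ b) (hl : |l| * b ≤ 1) :
    mgf X P l ≤ Real.exp (l * ∫ ω, X ω ∂P + l ^ 2 * ∫ ω, X ω ^ 2 ∂P) := by
  have hInt : Integrable X P := Integrable.of_bound hX.aestronglyMeasurable b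
    (Eventually.of_forall hb)
  have hsqInt : Integrable (fun ω => X ω ^ 2) P :=
    Integrable.of_bound (hX.pow_const 2).aestronglyMeasurable (b ^ 2)
      (Eventually.of_forall fun ω => by
        rw [Real.norm_eq_abs, abs_pow]; exact pow_le_pow_left₀ (abs_nonneg _) (hb ω) 2)
  have hlx : ∀ ω, |l * X ω| ≤ 1 := fun ω => by
    rw [abs_mul]
    exact (mul_le_mul_of_nonneg_left (hb ω) (abs_nonneg l)).trans hl
  have hle : ∀ ω, Real.exp (l * X ω) ≤ 1 + (l * X ω + l ^ 2 * X ω ^ 2) := fun ω => by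
    have := (abs_le.1 (Real.abs_exp_sub_one_sub_id_le (hlx ω))).2
    nlinarith
  have hexp : Integrable (fun ω => Real.exp (l * X ω)) P :=
    Integrable.of_bound (by fun_prop) (Real.exp 1) (Eventually.of_forall fun ω => by
      rw [Real.norm_eq_abs, abs_of_pos (Real.exp_pos _)]
      exact Real.exp_le_exp.2 ((le_abs_self _).trans (hlx ω)))
  have hquad : Integrable (fun ω => l * X ω + l ^ 2 * X ω ^ 2) P :=
    (hInt.const_mul l).add (hsqInt.const_mul (l ^ 2))
  calc mgf X P l ≤ ∫ ω, (1 + (l * X ω + l ^ 2 * X ω ^ 2)) ∂P :=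
        integral_mono hexp ((integrable_const 1).add hquad) hle
    _ = 1 + (l * ∫ ω, X ω ∂P + l ^ 2 * ∫ ω, X ω ^ 2 ∂P) := by
        rw [integral_add (integrable_const 1) hquad,
          integral_add (hInt.const_mul l) (hsqInt.const_mul (l ^ 2)), integral_const_mul,
          integral_const_mul]
        simp
    _ ≤ _ := by
        rw [add_comm]
        exact Real.add_one_le_exp _

/-- One-sided exponential inequality for sums of independent bounded variables. -/
lemma measureReal_sum_ge_le {Ω : Type*} [MeasurableSpace Ω] {P : Measure Ω}
    [IsProbabilityMeasure P] {X : ℕ → Ω → ℝ} (hX : ∀ i, Measurable (X i)) (hind : iIndepFun X P)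
    {b l u v : ℝ} (hb : ∀ i ω, |X i ω| ≤ b) (hl0 : 0 ≤ l) (hl : l * b ≤ 1)
    (hu : ∀ i, ∫ ω, X i ω ∂P ≤ u) (hv : ∀ i, ∫ ω, X i ω ^ 2 ∂P ≤ v) (n : ℕ) (s : ℝ) :
    P.real {ω | s ≤ ∑ j ∈ Finset.range n, X j ω}
      ≤ Real.exp (-(l * s) + n * (l * u + l ^ 2 * v)) := by
  have hmeas : Measurable fun ω => ∑ j ∈ Finset.range n, X j ω :=
    Finset.measurable_sum _ fun i _ => hX i
  have hexp : Integrable (fun ω => Real.exp (l * ∑ j ∈ Finset.range n, X j ω)) P := by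
    refine Integrable.of_bound (by fun_prop) (Real.exp (l * (n * b)))
      (Eventually.of_forall fun ω => ?_)
    rw [Real.norm_eq_abs, abs_of_pos (Real.exp_pos _), Real.exp_le_exp]
    refine mul_le_mul_of_nonneg_left ?_ hl0
    calc ∑ j ∈ Finset.range n, X j ω ≤ ∑ j ∈ Finset.range n, b :=
          Finset.sum_le_sum fun j _ => (le_abs_self _).trans (hb j ω)
      _ = n * b := by simp
  have h1 := measure_ge_le_exp_mul_mgf s hl0 hexp
  have h2 : mgf (fun ω => ∑ j ∈ Finset.range n, X j ω) P l
      = ∏ j ∈ Finset.range n, mgf (X j) P l := by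
    rw [← hind.mgf_sum hX]
    congr 1
    ext ω
    simp
  have h3 : ∏ j ∈ Finset.range n, mgf (X j) P l ≤ Real.exp (n * (l * u + l ^ 2 * v)) := by
    calc ∏ j ∈ Finset.range n, mgf (X j) P l
        ≤ ∏ j ∈ Finset.range n, Real.exp (l * u + l ^ 2 * v) := by
          refine Finset.prod_le_prod (fun j _ => mgf_nonneg) fun j _ => ?_
          refine (mgf_le_exp_of_bounded (hX j) (hb j) (by rwa [abs_of_nonneg hl0])).trans ?_
          rw [Real.exp_le_exp]
          have := hu j
          have := hv j
          gcongr
      _ = _ := by simp [← Real.exp_nat_mul]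
  rw [h2] at h1
  refine h1.trans ?_
  rw [Real.exp_add, neg_mul]
  gcongr

/-- Two-sided exponential inequality for sums of independent bounded variables. -/
lemma measureReal_abs_sum_ge_le {Ω : Type*} [MeasurableSpace Ω] {P : Measure Ω}
    [IsProbabilityMeasure P] {X : ℕ → Ω → ℝ} (hX : ∀ i, Measurable (X i)) (hind : iIndepFun X P)
    {b l u v : ℝ} (hb : ∀ i ω, |X i ω| ≤ b) (hl0 : 0 ≤ l) (hl : l * b ≤ 1)
    (hu : ∀ i, |∫ ω, X i ω ∂P| ≤ u) (hv : ∀ i, ∫ ω, X i ω ^ 2 ∂P ≤ v) (n : ℕ) (s : ℝ) :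
    P.real {ω | s ≤ |∑ j ∈ Finset.range n, X j ω|}
      ≤ 2 * Real.exp (-(l * s) + n * (l * u + l ^ 2 * v)) := by
  have h1 := measureReal_sum_ge_le hX hind hb hl0 hl (fun i => (le_abs_self _).trans (hu i)) hv n s
  have h2 := measureReal_sum_ge_le (X := fun i ω => -X i ω) (fun i => (hX i).neg)
    (hind.comp (fun _ x => -x) fun _ => measurable_neg) (b := b) (by simpa using hb) hl0 hl
    (fun i => by rw [integral_neg]; exact (neg_le_abs _).trans (hu i)) (by simpa using hv) n s
  have hsub : {ω | s ≤ |∑ j ∈ Finset.range n, X j ω|} ⊆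
      {ω | s ≤ ∑ j ∈ Finset.range n, X j ω} ∪ {ω | s ≤ ∑ j ∈ Finset.range n, -X j ω} := by
    intro ω hω
    rw [Set.mem_union]
    simpa [le_abs] using hω
  calc _ ≤ _ := measureReal_mono hsub
    _ ≤ _ := measureReal_union_le _ _
    _ ≤ _ := by linarith

/-- Hard truncation of `e` at level `T`. -/
noncomputable def truncAt (T e : ℝ) : ℝ := if |e| ≤ T then e else 0

lemma measurable_truncAt (T : ℝ) : Measurable (truncAt T) :=
  Measurable.ite (measurableSet_le (by fun_prop) measurable_const) measurable_id measurable_const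

lemma truncAt_of_abs_le {T e : ℝ} (h : |e| ≤ T) : truncAt T e = e := if_pos h

lemma abs_truncAt_le {T : ℝ} (hT : 0 ≤ T) (e : ℝ) : |truncAt T e| ≤ T := by
  unfold truncAt
  split_ifs with h
  · exact h
  · simpa using hT

lemma abs_truncAt_le_abs (T e : ℝ) : |truncAt T e| ≤ |e| := by
  unfold truncAt
  split_ifs with h
  · exact le_rfl
  · simp

lemma abs_truncAt_sub_le {T β : ℝ} (hT : 0 < T) (hβ : 1 ≤ β) (e : ℝ) :
    |truncAt T e - e| ≤ T ^ (1 - β) * |e| ^ β := by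
  unfold truncAt
  split_ifs with h
  · rw [sub_self, abs_zero]; positivity
  · push Not at h
    have he : 0 < |e| := hT.trans h
    calc |0 - e| = |e| ^ (1 - β) * |e| ^ β := by
          rw [← Real.rpow_add he]; simp
      _ ≤ T ^ (1 - β) * |e| ^ β := by
          gcongr ?_ * _
          exact Real.rpow_le_rpow_of_nonpos hT h.le (by linarith)

/-- A truncated centred variable has small mean. -/
lemma abs_integral_truncAt_le {Ω : Type*} [MeasurableSpace Ω] {P : Measure Ω}
    {e : Ω → ℝ} (he : Integrable e P) (hmean : ∫ ω, e ω ∂P = 0)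
    {β T : ℝ} (hβ : 1 ≤ β) (hT : 0 < T) (hmom : Integrable (fun ω => |e ω| ^ β) P) :
    |∫ ω, truncAt T (e ω) ∂P| ≤ T ^ (1 - β) * ∫ ω, |e ω| ^ β ∂P := by
  have htr : Integrable (fun ω => truncAt T (e ω)) P :=
    he.mono ((measurable_truncAt T).comp_aemeasurable he.aemeasurable).aestronglyMeasurable
      (Eventually.of_forall fun ω => abs_truncAt_le_abs T (e ω))
  have h : ∫ ω, truncAt T (e ω) ∂P = ∫ ω, (truncAt T (e ω) - e ω) ∂P := by
    rw [integral_sub htr he, hmean, sub_zero]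
  rw [h, ← integral_const_mul]
  exact norm_integral_le_of_norm_le (f := fun ω => truncAt T (e ω) - e ω) (hmom.const_mul _)
    (Eventually.of_forall fun ω => abs_truncAt_sub_le hT hβ (e ω))

/-- A variable with density bounded by `C` falls in an interval of radius `c` with probability at
most `2 * C * c`. -/
lemma measureReal_Icc_le_of_density {Ω : Type*} [MeasurableSpace Ω] {P : Measure Ω}
    {Z : Ω → ℝ} (hZ : Measurable Z) {g : ℝ → ℝ} {C : ℝ} (hC0 : 0 ≤ C)
    (hg : Measure.map Z P = volume.withDensity fun x => ENNReal.ofReal (g x))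
    (hC : ∀ x, g x ≤ C) {c : ℝ} (hc : 0 ≤ c) (x : ℝ) :
    P.real (Z ⁻¹' Set.Icc (x - c) (x + c)) ≤ 2 * C * c := by
  refine ENNReal.toReal_le_of_le_ofReal (by positivity) ?_
  rw [← Measure.map_apply hZ measurableSet_Icc, hg, withDensity_apply _ measurableSet_Icc]
  calc ∫⁻ a in Set.Icc (x - c) (x + c), ENNReal.ofReal (g a)
      ≤ ∫⁻ _ in Set.Icc (x - c) (x + c), ENNReal.ofReal C :=
        lintegral_mono fun a => ENNReal.ofReal_le_ofReal (hC a)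
    _ = ENNReal.ofReal (2 * C * c) := by
        rw [setLIntegral_const, Real.volume_Icc, ← ENNReal.ofReal_mul hC0]
        congr 1; ring

/-- Second moment of a kernel weight under a bounded density. -/
lemma integral_kernel_sq_le {Ω : Type*} [MeasurableSpace Ω] {P : Measure Ω}
    [IsProbabilityMeasure P] {Z : Ω → ℝ} (hZ : Measurable Z) {g : ℝ → ℝ} {C : ℝ} (hC0 : 0 ≤ C)
    (hg : Measure.map Z P = volume.withDensity fun x => ENNReal.ofReal (g x))
    (hC : ∀ x, g x ≤ C) {φ : ℝ → ℝ} {B : ℝ} (hB : ∀ t, |φ t| ≤ B)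
    (hsupp : Function.support φ ⊆ Set.Icc (-1) 1) {c : ℝ} (hc : 0 < c) (x : ℝ) :
    ∫ ω, φ ((Z ω - x) / c) ^ 2 ∂P ≤ B ^ 2 * (2 * C * c) := by
  have hS : MeasurableSet (Z ⁻¹' Set.Icc (x - c) (x + c)) := hZ measurableSet_Icc
  calc ∫ ω, φ ((Z ω - x) / c) ^ 2 ∂P
      ≤ ∫ ω, (Z ⁻¹' Set.Icc (x - c) (x + c)).indicator (fun _ => B ^ 2) ω ∂P := by
        refine integral_mono_of_nonneg (Eventually.of_forall fun ω => sq_nonneg _)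
          ((integrable_const _).indicator hS) (Eventually.of_forall fun ω => ?_)
        by_cases hω : ω ∈ Z ⁻¹' Set.Icc (x - c) (x + c)
        · simp only [Set.indicator_of_mem hω]
          rw [← sq_abs]
          exact pow_le_pow_left₀ (abs_nonneg _) (hB _) 2
        · simp only [Set.indicator_of_notMem hω]
          have : φ ((Z ω - x) / c) = 0 := by
            refine Function.notMem_support.1 fun h => hω ?_
            obtain ⟨h1, h2⟩ := hsupp h
            rw [le_div_iff₀ hc] at h1
            rw [div_le_iff₀ hc] at h2
            constructor <;> linarith
          simp [this]
    _ = B ^ 2 * P.real (Z ⁻¹' Set.Icc (x - c) (x + c)) := by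
        rw [integral_indicator_const _ hS, smul_eq_mul, mul_comm]
    _ ≤ _ := by
        gcongr
        exact measureReal_Icc_le_of_density hZ hC0 hg hC hc.le x

/-- Tail bound for the kernel-weighted sum of truncated errors at a fixed point. -/
lemma measureReal_kernel_sum_ge_le {Ω : Type*} [MeasurableSpace Ω] {P : Measure Ω}
    [IsProbabilityMeasure P] {Z ε : ℕ → Ω → ℝ} (hZmeas : ∀ i, Measurable (Z i))
    (hεmeas : ∀ i, Measurable (ε i)) (hiid : iIndepFun (fun i ω => (Z i ω, ε i ω)) P)
    (hident : ∀ i, Measure.map (fun ω => (Z i ω, ε i ω)) P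
      = Measure.map (fun ω => (Z 0 ω, ε 0 ω)) P)
    (hZε : ∀ i, IndepFun (Z i) (ε i) P) {g : ℝ → ℝ} {C : ℝ} (hC0 : 0 ≤ C)
    (hg : Measure.map (Z 0) P = volume.withDensity fun x => ENNReal.ofReal (g x))
    (hC : ∀ x, g x ≤ C) (hεint : Integrable (ε 0) P) (hεmean : ∫ ω, ε 0 ω ∂P = 0)
    (hεsq : Integrable (fun ω => ε 0 ω ^ 2) P)
    {β : ℝ} (hβ : 1 ≤ β) (hεmom : Integrable (fun ω => |ε 0 ω| ^ β) P)
    {φ : ℝ → ℝ} (hφ : Measurable φ) {B : ℝ} (hB : ∀ t, |φ t| ≤ B)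
    (hsupp : Function.support φ ⊆ Set.Icc (-1) 1) {c T l : ℝ} (hc : 0 < c) (hT : 0 < T)
    (hl0 : 0 ≤ l) (hl : l * (B * T) ≤ 1) (n : ℕ) (x s : ℝ) :
    P.real {ω | s ≤ |∑ j ∈ Finset.range n, φ ((Z j ω - x) / c) * truncAt T (ε j ω)|}
      ≤ 2 * Real.exp (-(l * s) + n * (l * (B * (T ^ (1 - β) * ∫ ω, |ε 0 ω| ^ β ∂P))
        + l ^ 2 * (B ^ 2 * (2 * C * c) * ∫ ω, ε 0 ω ^ 2 ∂P))) := by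
  have hB0 : 0 ≤ B := (abs_nonneg _).trans (hB 0)
  have hφx : Measurable fun z => φ ((z - x) / c) := hφ.comp (by fun_prop)
  have htr := measurable_truncAt T
  set G : ℝ × ℝ → ℝ := fun p => φ ((p.1 - x) / c) * truncAt T p.2 with hG
  have hGmeas : Measurable G := (hφx.comp measurable_fst).mul (htr.comp measurable_snd)
  have hpair : ∀ i, Measurable fun ω => (Z i ω, ε i ω) := fun i => (hZmeas i).prodMk (hεmeas i)
  have hid : ∀ i, IdentDistrib (fun ω => (Z i ω, ε i ω)) (fun ω => (Z 0 ω, ε 0 ω)) P P :=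
    fun i => ⟨(hpair i).aemeasurable, (hpair 0).aemeasurable, hident i⟩
  have hmean : ∀ i, |∫ ω, G (Z i ω, ε i ω) ∂P|
      ≤ B * (T ^ (1 - β) * ∫ ω, |ε 0 ω| ^ β ∂P) := by
    intro i
    have heq := ((hid i).comp hGmeas).integral_eq
    simp only [Function.comp_def] at heq
    rw [heq]
    have hind := (hZε 0).comp hφx htr
    have := hind.integral_fun_mul_eq_mul_integral
      (hφx.comp (hZmeas 0)).aestronglyMeasurable (htr.comp (hεmeas 0)).aestronglyMeasurable
    simp only [Function.comp_def] at this
    simp only [hG]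
    rw [this, abs_mul]
    refine mul_le_mul ?_ (abs_integral_truncAt_le hεint hεmean hβ hT hεmom) (abs_nonneg _) hB0
    simpa using norm_integral_le_of_norm_le_const (μ := P)
      (f := fun ω => φ ((Z 0 ω - x) / c)) (Eventually.of_forall fun ω => hB _)
  have hsq : ∀ i, ∫ ω, G (Z i ω, ε i ω) ^ 2 ∂P
      ≤ B ^ 2 * (2 * C * c) * ∫ ω, ε 0 ω ^ 2 ∂P := by
    intro i
    have := ((hid i).comp (hGmeas.pow_const 2)).integral_eq
    simp only [Function.comp_def] at this
    rw [this]
    have hind := (hZε 0).comp (hφx.pow_const 2) (htr.pow_const 2)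
    have := hind.integral_fun_mul_eq_mul_integral
      ((hφx.pow_const 2).comp (hZmeas 0)).aestronglyMeasurable
      ((htr.pow_const 2).comp (hεmeas 0)).aestronglyMeasurable
    simp only [Function.comp_def] at this
    simp only [hG, mul_pow]
    rw [this]
    refine mul_le_mul (integral_kernel_sq_le (hZmeas 0) hC0 hg hC hB hsupp hc x) ?_
      (integral_nonneg fun ω => sq_nonneg _) (by positivity)
    refine integral_mono_of_nonneg (Eventually.of_forall fun ω => sq_nonneg _) hεsq
      (Eventually.of_forall fun ω => ?_)
    exact sq_le_sq.2 (abs_truncAt_le_abs T _)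
  refine measureReal_abs_sum_ge_le (X := fun i ω => G (Z i ω, ε i ω))
    (fun i => hGmeas.comp (hpair i)) (hiid.comp (fun _ => G) fun _ => hGmeas) (b := B * T)
    (fun i ω => ?_) hl0 hl hmean hsq n s
  simp only [hG, abs_mul]
  exact mul_le_mul (hB _) (abs_truncAt_le hT.le _) (abs_nonneg _) hB0

/-- Passing from a grid of mesh `1 / N` to all `x ∈ [0, 1]` in the smoother. -/
lemma abs_smoother_le_of_grid {g w : ℝ → ℝ} {d : ℕ} {K L c T s x : ℝ} {n N : ℕ}
    (hc : 0 < c) (hN : 0 < N) (hn : 0 < n) (hL : 0 < L) (hx : x ∈ Set.Icc (0 : ℝ) 1)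
    (hK : ∀ m : Fin (d + 1), |(Qbar g w c d x)⁻¹ m 0| ≤ K)
    (hLip : ∀ m ≤ d, ∀ s t : ℝ, |s ^ m * w s - t ^ m * w t| ≤ L * |s - t|)
    {z e : ℕ → ℝ} (he : ∀ j < n, |e j| ≤ T)
    (hgrid : ∀ m ≤ d, ∀ k ≤ N, |∑ j ∈ Finset.range n,
      ((z j - k / N) / c) ^ m * w ((z j - k / N) / c) * e j| ≤ s) :
    |(n : ℝ)⁻¹ * ∑ j ∈ Finset.range n, Abar g w c d x (z j) * e j|
      ≤ (d + 1) * (K * ((n : ℝ)⁻¹ * c⁻¹ * (s + n * (L * (1 / (N * c)) * T)))) := by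
  have hNr : (0 : ℝ) < N := by exact_mod_cast hN
  have hT : 0 ≤ T := (abs_nonneg _).trans (he 0 hn)
  have hexpand : (n : ℝ)⁻¹ * ∑ j ∈ Finset.range n, Abar g w c d x (z j) * e j
      = ∑ m : Fin (d + 1), (Qbar g w c d x)⁻¹ m 0 * ((n : ℝ)⁻¹ * c⁻¹ * ∑ j ∈ Finset.range n,
        ((z j - x) / c) ^ (m : ℕ) * w ((z j - x) / c) * e j) := by
    simp only [Abar, Finset.sum_mul, Finset.mul_sum]
    rw [Finset.sum_comm]
    refine Finset.sum_congr rfl fun m _ => Finset.sum_congr rfl fun j _ => ?_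
    rw [wnm, div_pow, pow_succ]
    field_simp
  set k := ⌊x * N⌋₊ with hk
  have hkN : k ≤ N := by
    rw [hk]
    refine Nat.floor_le_of_le ?_
    nlinarith [hx.2]
  have hxk : |x - k / N| ≤ 1 / N := by
    have h1 : (k : ℝ) ≤ x * N := Nat.floor_le (mul_nonneg hx.1 hNr.le)
    have h2 : x * N < k + 1 := Nat.lt_floor_add_one _
    have h3 : x - k / N = (x * N - k) / N := by field_simp
    rw [h3, abs_of_nonneg (div_nonneg (by linarith) hNr.le)]
    gcongr
    linarith
  have hpoint : ∀ m ≤ d, |∑ j ∈ Finset.range n,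
      ((z j - x) / c) ^ m * w ((z j - x) / c) * e j| ≤ s + n * (L * (1 / (N * c)) * T) := by
    intro m hm
    have hdiff : |∑ j ∈ Finset.range n, (((z j - x) / c) ^ m * w ((z j - x) / c)
        - ((z j - k / N) / c) ^ m * w ((z j - k / N) / c)) * e j|
        ≤ n * (L * (1 / (N * c)) * T) := by
      calc _ ≤ ∑ j ∈ Finset.range n, |(((z j - x) / c) ^ m * w ((z j - x) / c)
            - ((z j - k / N) / c) ^ m * w ((z j - k / N) / c)) * e j| :=
            Finset.abs_sum_le_sum_abs _ _
        _ ≤ ∑ j ∈ Finset.range n, L * (1 / (N * c)) * T := by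
            refine Finset.sum_le_sum fun j hj => ?_
            rw [abs_mul]
            refine mul_le_mul ((hLip m hm _ _).trans ?_) (he j (Finset.mem_range.1 hj))
              (abs_nonneg _) (by positivity)
            gcongr
            rw [← sub_div, abs_div, abs_of_pos hc, ← div_div]
            gcongr
            rw [show z j - x - (z j - k / N) = -(x - k / N) by ring, abs_neg]
            exact hxk
        _ = _ := by simp
    calc |∑ j ∈ Finset.range n, ((z j - x) / c) ^ m * w ((z j - x) / c) * e j|
        = |(∑ j ∈ Finset.range n, ((z j - k / N) / c) ^ m * w ((z j - k / N) / c) * e j)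
          + ∑ j ∈ Finset.range n, (((z j - x) / c) ^ m * w ((z j - x) / c)
            - ((z j - k / N) / c) ^ m * w ((z j - k / N) / c)) * e j| := by
          rw [← Finset.sum_add_distrib]
          congr 1
          refine Finset.sum_congr rfl fun j _ => ?_
          ring
      _ ≤ _ := (abs_add_le _ _).trans (add_le_add (hgrid m hm k hkN) hdiff)
  have hK0 : 0 ≤ K := (abs_nonneg _).trans (hK 0)
  rw [hexpand]
  calc _ ≤ ∑ m : Fin (d + 1), |(Qbar g w c d x)⁻¹ m 0 * ((n : ℝ)⁻¹ * c⁻¹ *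
          ∑ j ∈ Finset.range n, ((z j - x) / c) ^ (m : ℕ) * w ((z j - x) / c) * e j)| :=
        Finset.abs_sum_le_sum_abs _ _
    _ ≤ ∑ m : Fin (d + 1), K * ((n : ℝ)⁻¹ * c⁻¹ * (s + n * (L * (1 / (N * c)) * T))) := by
        refine Finset.sum_le_sum fun m _ => ?_
        rw [abs_mul, abs_mul, abs_of_nonneg (by positivity : 0 ≤ (n : ℝ)⁻¹ * c⁻¹)]
        exact mul_le_mul (hK m) (mul_le_mul_of_nonneg_left (hpoint m (Nat.lt_succ_iff.1 m.2))
          (by positivity)) (by positivity) hK0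
    _ = _ := by simp

/-- The rate `r = (n c / log n)^(-1/2)` and the consequences of the bandwidth condition. -/
lemma rate_properties {β c C : ℝ} {n : ℕ} (hn : 3 ≤ n) (hβ : 2 < β) (hc : 0 < c) (hC : 0 ≤ C)
    (h : c⁻¹ * (n : ℝ) ^ (2 / β) ≤ C * n / Real.log n) :
    ∃ r > 0, ((n : ℝ) * c / Real.log n) ^ (-(1 : ℝ) / 2) = r ∧ n * c * r ^ 2 = Real.log n ∧
      (n : ℝ) ^ (1 / β) * r ≤ Real.sqrt C ∧ 1 / ((n : ℝ) ^ 2 * c ^ 2) ≤ C * r ^ 2 := by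
  have hn3 : (3 : ℝ) ≤ n := by exact_mod_cast hn
  have hn0 : (0 : ℝ) < n := by linarith
  have hlog : 1 ≤ Real.log n := by
    rw [Real.le_log_iff_exp_le hn0]
    linarith [Real.exp_one_lt_d9]
  have hlog0 : 0 < Real.log n := by linarith
  have hq : 0 < (n : ℝ) * c / Real.log n := by positivity
  have hr2 : (((n : ℝ) * c / Real.log n) ^ (-(1 : ℝ) / 2)) ^ 2 = Real.log n / (n * c) := by
    rw [← Real.rpow_natCast, ← Real.rpow_mul hq.le]
    norm_num
    rw [Real.rpow_neg_one, inv_div]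
  refine ⟨_, Real.rpow_pos_of_pos hq _, rfl, ?_, ?_, ?_⟩
  · rw [hr2]; field_simp
  · refine Real.le_sqrt_of_sq_le ?_
    rw [mul_pow, hr2, ← Real.rpow_natCast, ← Real.rpow_mul hn0.le]
    have : (1 / β * (2 : ℕ) : ℝ) = 2 / β := by push_cast; ring
    rw [this]
    rw [le_div_iff₀ hlog0] at h
    calc (n : ℝ) ^ (2 / β) * (Real.log n / (n * c))
        = (c⁻¹ * (n : ℝ) ^ (2 / β) * Real.log n) / n := by field_simp
      _ ≤ C * n / n := by gcongr
      _ = C := by field_simp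
  · rw [hr2]
    have h1 : 1 ≤ (n : ℝ) ^ (2 / β) := Real.one_le_rpow (by linarith) (by positivity)
    have h2 : c⁻¹ ≤ C * n * Real.log n := by
      calc c⁻¹ ≤ c⁻¹ * (n : ℝ) ^ (2 / β) := le_mul_of_one_le_right (by positivity) h1
        _ ≤ C * n / Real.log n := h
        _ ≤ C * n := div_le_self (by positivity) hlog
        _ ≤ C * n * Real.log n := le_mul_of_one_le_right (by positivity) hlog
    calc 1 / ((n : ℝ) ^ 2 * c ^ 2) = c⁻¹ * (1 / (n ^ 2 * c)) := by field_simp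
      _ ≤ C * n * Real.log n * (1 / (n ^ 2 * c)) := by gcongr
      _ = C * (Real.log n / (n * c)) := by field_simp

lemma natCast_mul_rpow_neg_scaled {τ β : ℝ} {n : ℕ} (hn : 0 < n) (hτ : 0 < τ) (hβ : 0 < β) :
    (n : ℝ) * (τ * (n : ℝ) ^ (1 / β)) ^ (-β) = τ ^ (-β) := by
  have hn0 : (0 : ℝ) < n := by exact_mod_cast hn
  rw [Real.mul_rpow hτ.le (by positivity), ← Real.rpow_mul hn0.le]
  have : 1 / β * -β = -1 := by field_simp
  rw [this, Real.rpow_neg_one]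
  field_simp

/-- Markov's inequality for the absolute moment of order `β`. -/
lemma measureReal_lt_abs_le {Ω : Type*} [MeasurableSpace Ω] {P : Measure Ω}
    [IsProbabilityMeasure P] {e : Ω → ℝ} {β T : ℝ} (hβ : 0 < β) (hT : 0 < T)
    (hmom : Integrable (fun ω => |e ω| ^ β) P) :
    P.real {ω | T < |e ω|} ≤ (∫ ω, |e ω| ^ β ∂P) * T ^ (-β) := by
  have h := mul_meas_ge_le_integral_of_nonneg
    (Eventually.of_forall fun ω => Real.rpow_nonneg (abs_nonneg (e ω)) β) hmom (T ^ β)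
  have hsub : {ω | T < |e ω|} ⊆ {ω | T ^ β ≤ |e ω| ^ β} := fun ω hω =>
    Real.rpow_le_rpow hT.le (le_of_lt hω) hβ.le
  rw [Real.rpow_neg hT.le, ← div_eq_mul_inv, le_div_iff₀ (by positivity), mul_comm]
  exact (mul_le_mul_of_nonneg_left (measureReal_mono hsub) (by positivity)).trans h

lemma integrable_sq_of_integrable_rpow {Ω : Type*} [MeasurableSpace Ω] {P : Measure Ω}
    [IsProbabilityMeasure P] {e : Ω → ℝ} {β : ℝ} (he : Measurable e) (hβ : 2 ≤ β)
    (hmom : Integrable (fun ω => |e ω| ^ β) P) : Integrable (fun ω => e ω ^ 2) P := by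
  refine ((integrable_const 1).add hmom).mono' (he.pow_const 2).aestronglyMeasurable
    (Eventually.of_forall fun ω => ?_)
  rw [Real.norm_eq_abs, abs_pow, Pi.add_apply]
  rcases le_total |e ω| 1 with h | h
  · have h1 : |e ω| ^ 2 ≤ 1 := pow_le_one₀ (abs_nonneg _) h
    have h2 : 0 ≤ |e ω| ^ β := by positivity
    linarith
  · have := Real.rpow_le_rpow_of_exponent_le h hβ
    rw [Real.rpow_two] at this
    linarith

/-- Theorem lls, display (ae): under Assumptions G and W, if `f` has
mean zero and a finite absolute moment of order `β > 2`, and `c_n → 0` with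
`c_n⁻¹ n^{2/β} = O(n / log n)`, then
`sup_{0≤x≤1} |(1/n) Σ_j Ā_n(x, Z_j) ε_j| = O_p((n c_n / log n)^{-1/2})`. -/
theorem local_poly_stochastic_term_Op {Ω : Type*} [MeasurableSpace Ω] (P : Measure Ω)
    [IsProbabilityMeasure P]
    (Z ε : ℕ → Ω → ℝ) (hZmeas : ∀ i, Measurable (Z i)) (hεmeas : ∀ i, Measurable (ε i))
    (hiid : iIndepFun (fun i ω => (Z i ω, ε i ω)) P)
    (hident : ∀ i, Measure.map (fun ω => (Z i ω, ε i ω)) P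
      = Measure.map (fun ω => (Z 0 ω, ε 0 ω)) P)
    (hZε : ∀ i, IndepFun (Z i) (ε i) P)
    (g f : ℝ → ℝ)
    (hgdens : Measure.map (Z 0) P = volume.withDensity fun x => ENNReal.ofReal (g x))
    (hfdens : Measure.map (ε 0) P = volume.withDensity fun x => ENNReal.ofReal (f x))
    -- Assumption G
    (hg0 : ∀ x, 0 ≤ g x) (hgbdd : ∃ C, ∀ x, g x ≤ C)
    (hglow : ∃ c₀ > (0 : ℝ), ∀ x ∈ Set.Icc (0 : ℝ) 1, c₀ ≤ g x)
    (hgUC : UniformContinuousOn g (Set.Icc 0 1))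
    -- Assumption W
    (w : ℝ → ℝ) (hw0 : ∀ x, 0 ≤ w x) (hwInt : Integrable w) (hwdens : ∫ x, w x = 1)
    (hwsym : ∀ x, w (-x) = w x) (hwsupp : Function.support w ⊆ Set.Icc (-1) 1)
    (hwdiff : Differentiable ℝ w) (hwderiv : ∃ M, ∀ x, |deriv w x| ≤ M)
    -- error moments
    (hεint : Integrable (ε 0) P) (hεmean : ∫ ω, ε 0 ω ∂P = 0)
    (β : ℝ) (hβ : 2 < β) (hεmom : Integrable (fun ω => |ε 0 ω| ^ β) P)
    -- order of the smoother and bandwidths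
    (d : ℕ) (c : ℕ → ℝ) (hcpos : ∀ n, 0 < c n)
    (hc0 : Tendsto c atTop (nhds 0))
    (hcO : ∃ C : ℝ, ∀ n : ℕ, 2 ≤ n →
        (c n)⁻¹ * (n : ℝ) ^ (2 / β) ≤ C * n / Real.log n) :
    ∀ δ > (0 : ℝ), ∃ M : ℝ, Filter.limsup (fun n : ℕ =>
        P {ω | (⨆ x : Set.Icc (0 : ℝ) 1,
            |(n : ℝ)⁻¹ * ∑ j ∈ Finset.range n, Abar g w (c n) d x (Z j ω) * ε j ω|)
          > M * ((n : ℝ) * c n / Real.log n) ^ (-(1 : ℝ) / 2)})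
        atTop < ENNReal.ofReal δ := by
  intro δ hδ
  obtain ⟨Cg, hCg⟩ := hgbdd
  have hCg0 : 0 ≤ Cg := (hg0 0).trans (hCg 0)
  obtain ⟨K, hK0, hK⟩ := exists_bound_Qbar_inv hg0 ⟨Cg, hCg⟩ hglow hw0 hwInt hwdens hwsym hwsupp
    hwdiff.continuous d
  obtain ⟨B, hB0, L, hL0, hBL⟩ := exists_bound_lipschitz_pow_mul hwsupp hwdiff hwderiv d
  have hβ0 : 0 < β := by linarith
  have hεsq : Integrable (fun ω => ε 0 ω ^ 2) P := integrable_sq_of_integrable_rpow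
    (hεmeas 0) hβ.le hεmom
  set E : ℝ := ∫ ω, |ε 0 ω| ^ β ∂P
  have hE0 : 0 ≤ E := integral_nonneg fun ω => by positivity
  set V : ℝ := B ^ 2 * (2 * Cg) * ∫ ω, ε 0 ω ^ 2 ∂P with hV
  obtain ⟨C₁, hC₁⟩ := hcO
  set C : ℝ := max C₁ 1
  have hC1 : 1 ≤ C := le_max_right _ _
  have hκ0 : 0 < Real.sqrt C := Real.sqrt_pos.2 (by linarith)
  obtain ⟨τ, hτ, hτ0⟩ : ∃ τ : ℝ, E * τ ^ (-β) < min (δ / 4) 1 ∧ 0 < τ := by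
    have h : Tendsto (fun τ : ℝ => E * τ ^ (-β)) atTop (nhds 0) := by
      simpa using (tendsto_rpow_neg_atTop hβ0).const_mul E
    exact ((h.eventually_lt_const (lt_min (by positivity) one_pos)).and
      (eventually_gt_atTop 0)).exists
  set a : ℝ := 1 / (B * τ * Real.sqrt C) with ha
  have ha0 : 0 < a := by positivity
  set M₁ : ℝ := a * V + 3 / a with hM₁
  refine ⟨(d + 1) * (K * (M₁ + L * (C * (τ * Real.sqrt C)))), ?_⟩
  have hsmall : ∀ᶠ n : ℕ in atTop, (d + 1) * (4 * Real.exp 1) / (n : ℝ) < δ / 4 :=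
    (tendsto_const_div_atTop_nhds_zero_nat _).eventually_lt_const (by positivity)
  have hcsmall : ∀ᶠ n : ℕ in atTop, c n < 1 / 2 := hc0.eventually_lt_const (by norm_num)
  refine (limsup_le_of_le (a := ENNReal.ofReal (δ / 2)) (by isBoundedDefault) ?_).trans_lt
    ((ENNReal.ofReal_lt_ofReal_iff hδ).2 (by linarith))
  filter_upwards [eventually_ge_atTop 3, hsmall, hcsmall] with n hn3 hn_small hcn
  have hn0 : 0 < n := by omega
  have hnr : (0 : ℝ) < n := by exact_mod_cast hn0
  have hnr1 : (1 : ℝ) ≤ n := by exact_mod_cast hn0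
  have hcn0 := hcpos n
  have hlog : 0 < Real.log n := Real.log_pos (by exact_mod_cast (by omega : 1 < n))
  obtain ⟨r, hr0, hr, hr2, hrT, hrc⟩ := rate_properties (C := C) hn3 hβ hcn0 (by linarith)
    ((hC₁ n (by omega)).trans (by gcongr; exact le_max_left _ _))
  rw [hr]
  set T : ℝ := τ * (n : ℝ) ^ (1 / β) with hT
  have hT0 : 0 < T := by positivity
  have hTr : T * r ≤ τ * Real.sqrt C := by
    rw [hT, mul_assoc]; gcongr
  have hnT : (n : ℝ) * T ^ (-β) = τ ^ (-β) := natCast_mul_rpow_neg_scaled hn0 hτ0 hβ0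
  set s : ℝ := M₁ * (n * c n * r) with hs
  set badErr : ℕ → Set Ω := fun j => {ω | T < |ε j ω|}
  set badGrid : ℕ × ℕ → Set Ω := fun p => {ω | s ≤ |∑ j ∈ Finset.range n,
    ((Z j ω - p.2 / (n ^ 2 : ℕ)) / c n) ^ p.1 * w ((Z j ω - p.2 / (n ^ 2 : ℕ)) / c n)
      * truncAt T (ε j ω)|}
  set I : Finset (ℕ × ℕ) := Finset.range (d + 1) ×ˢ Finset.range (n ^ 2 + 1) with hI
  have hPerr : ∀ j, P.real (badErr j) ≤ E * T ^ (-β) := by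
    intro j
    have hid : IdentDistrib (fun ω => |ε j ω| ^ β) (fun ω => |ε 0 ω| ^ β) P P :=
      IdentDistrib.comp (u := fun p : ℝ × ℝ => |p.2| ^ β)
        ⟨((hZmeas j).prodMk (hεmeas j)).aemeasurable, ((hZmeas 0).prodMk (hεmeas 0)).aemeasurable,
          hident j⟩ (by fun_prop)
    have h := measureReal_lt_abs_le hβ0 hT0 (hid.integrable_iff.2 hεmom)
    rwa [hid.integral_eq] at h
  have hPgrid : ∀ p ∈ I, P.real (badGrid p) ≤ 2 * (Real.exp 1 / n ^ 3) := by
    intro p hp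
    have hp1 : p.1 ≤ d := by
      have := (Finset.mem_product.1 hp).1
      simpa [Nat.lt_succ_iff] using this
    have hlin : a * r * (B * T) ≤ 1 := by
      calc a * r * (B * T) = a * B * (T * r) := by ring
        _ ≤ a * B * (τ * Real.sqrt C) := by gcongr
        _ = 1 := by rw [ha]; field_simp
    refine (measureReal_kernel_sum_ge_le hZmeas hεmeas hiid hident hZε hCg0 hgdens hCg hεint hεmean
      hεsq (by linarith) hεmom (φ := fun t => t ^ p.1 * w t)
      ((by fun_prop : Measurable fun t : ℝ => t ^ p.1).mul hwdiff.continuous.measurable)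
      (hBL p.1 hp1).1 (fun t ht => hwsupp (right_ne_zero_of_mul ht)) hcn0 hT0
      (by positivity : 0 ≤ a * r) hlin n _ s).trans ?_
    have hexp3 : Real.exp 1 / (n : ℝ) ^ 3 = Real.exp (1 - 3 * Real.log n) := by
      rw [Real.exp_sub, mul_comm, Real.exp_mul, Real.exp_log hnr]
      norm_num
    rw [hexp3]
    gcongr
    have hTβ : T ^ (1 - β) = T * T ^ (-β) := by
      rw [sub_eq_add_neg, Real.rpow_add hT0, Real.rpow_one]
    have h1 : (n : ℝ) * (a * r * (B * (T ^ (1 - β) * E))) ≤ 1 := by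
      calc (n : ℝ) * (a * r * (B * (T ^ (1 - β) * E)))
          = (a * r * (B * T)) * (E * (n * T ^ (-β))) := by rw [hTβ]; ring
        _ ≤ 1 * 1 := by
          rw [hnT]
          exact mul_le_mul hlin (hτ.le.trans (min_le_right _ _)) (by positivity) zero_le_one
        _ = 1 := one_mul 1
    have h2 : (n : ℝ) * ((a * r) ^ 2 * (B ^ 2 * (2 * Cg * c n) * ∫ ω, ε 0 ω ^ 2 ∂P))
        = a ^ 2 * V * Real.log n := by
      rw [← hr2, hV]; ring
    have h3 : a * r * s = (a ^ 2 * V + 3) * Real.log n := by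
      rw [hs, ← hr2, hM₁]; field_simp
    rw [mul_add, h2, h3]
    linarith
  have hsub : {ω | (⨆ x : Set.Icc (0 : ℝ) 1,
      |(n : ℝ)⁻¹ * ∑ j ∈ Finset.range n, Abar g w (c n) d x (Z j ω) * ε j ω|)
        > (d + 1) * (K * (M₁ + L * (C * (τ * Real.sqrt C)))) * r} ⊆
      (⋃ j ∈ Finset.range n, badErr j) ∪ ⋃ p ∈ I, badGrid p := by
    intro ω hω
    by_contra hgood
    simp only [Set.mem_union, Set.mem_iUnion, not_or, not_exists] at hgood
    obtain ⟨hgoodErr, hgoodGrid⟩ := hgood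
    have he : ∀ j < n, |ε j ω| ≤ T := fun j hj =>
      not_lt.1 fun h => hgoodErr j (Finset.mem_range.2 hj) h
    rw [Set.mem_ofPred_eq, gt_iff_lt] at hω
    refine absurd (ciSup_le fun x => ?_) (not_le.2 hω)
    refine (abs_smoother_le_of_grid (K := K) (L := L) (T := T) (s := s) (N := n ^ 2) hcn0
      (by positivity) hn0 hL0 x.2 (hK _ hcn0 hcn.le x x.2) (fun m hm => (hBL m hm).2) he
      fun m hm k hk => ?_).trans ?_
    · have h := hgoodGrid (m, k) (Finset.mem_product.2
        ⟨Finset.mem_range.2 (Nat.lt_succ_iff.2 hm), Finset.mem_range.2 (Nat.lt_succ_iff.2 hk)⟩)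
      refine le_trans (le_of_eq ?_) (le_of_lt (not_le.1 h))
      congr 1
      refine Finset.sum_congr rfl fun j hj => ?_
      rw [truncAt_of_abs_le (he j (Finset.mem_range.1 hj))]
    · rw [mul_assoc ((d : ℝ) + 1), mul_assoc K]
      refine mul_le_mul_of_nonneg_left (mul_le_mul_of_nonneg_left ?_ hK0.le) (by positivity)
      calc (n : ℝ)⁻¹ * (c n)⁻¹ * (s + n * (L * (1 / ((n ^ 2 : ℕ) * c n)) * T))
          = M₁ * r + L * (1 / ((n : ℝ) ^ 2 * c n ^ 2)) * T := by
            rw [hs]; push_cast; field_simp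
        _ ≤ M₁ * r + L * (C * r ^ 2) * T := by gcongr
        _ = M₁ * r + L * C * r * (T * r) := by ring
        _ ≤ M₁ * r + L * C * r * (τ * Real.sqrt C) := by gcongr
        _ = _ := by ring
  have hPreal := calc
    P.real {ω | (⨆ x : Set.Icc (0 : ℝ) 1,
      |(n : ℝ)⁻¹ * ∑ j ∈ Finset.range n, Abar g w (c n) d x (Z j ω) * ε j ω|)
        > (d + 1) * (K * (M₁ + L * (C * (τ * Real.sqrt C)))) * r}
      ≤ P.real (⋃ j ∈ Finset.range n, badErr j) + P.real (⋃ p ∈ I, badGrid p) :=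
        (measureReal_mono hsub).trans (measureReal_union_le _ _)
    _ ≤ ∑ j ∈ Finset.range n, P.real (badErr j) + ∑ p ∈ I, P.real (badGrid p) :=
        add_le_add (measureReal_biUnion_finset_le _ _) (measureReal_biUnion_finset_le _ _)
    _ ≤ ∑ j ∈ Finset.range n, E * T ^ (-β) + ∑ p ∈ I, 2 * (Real.exp 1 / n ^ 3) :=
        add_le_add (Finset.sum_le_sum fun j _ => hPerr j) (Finset.sum_le_sum hPgrid)
    _ = E * τ ^ (-β) + (d + 1) * ((n : ℝ) ^ 2 + 1) * (2 * (Real.exp 1 / n ^ 3)) := by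
        simp only [Finset.sum_const, Finset.card_range, hI, Finset.card_product, nsmul_eq_mul,
          ← hnT]
        push_cast
        ring
    _ ≤ δ / 4 + (d + 1) * ((n : ℝ) ^ 2 + n ^ 2) * (2 * (Real.exp 1 / n ^ 3)) := by
        gcongr
        · exact hτ.le.trans (min_le_left _ _)
        · exact one_le_pow₀ hnr1
    _ = δ / 4 + (d + 1) * (4 * Real.exp 1) / (n : ℝ) := by field_simp; ring
    _ ≤ δ / 2 := by linarith
  rw [← ofReal_measureReal]
  exact ENNReal.ofReal_le_ofReal hPreal
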